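/- Let m, n be positive integers and σ > 0. Let W be a random real m×n matrix whose entries are independent centered Gaussian random variables with variance σ², and set S = WWᵀ. Then E[tr(S⁴)] = σ⁸ · n m · (n³ + m³ + 6n²m + 6nm² + 6n² + 6m² + 17nm + 21n + 21m + 20). -/

import Mathlib

open Matrix MeasureTheory ProbabilityTheory

/-- The law of a random real `m × n` matrix with i.i.d. centered Gaussian entries of
variance `σ²`: the product over all entries of the Gaussian measure `N(0, σ²)` on `ℝ`. -/
noncomputable def gaussianMatrixMeasure (m n : ℕ) (σ : ℝ) :
    Measure (Fin m → Fin n → ℝ) :=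
  Measure.pi fun _ => Measure.pi fun _ => gaussianReal 0 ⟨σ ^ 2, sq_nonneg σ⟩

theorem gaussMoment_zero (v : NNReal) : ∫ x, x ^ 0 ∂(gaussianReal 0 v) = 1 := by simp

theorem gaussMoment_eq (v : NNReal) (k : ℕ) : ∫ x, x ^ k ∂(gaussianReal 0 v)
    = iteratedDeriv k (fun t : ℝ => Real.exp (v * t ^ 2 / 2)) 0 := by
  have h := iteratedDeriv_mgf_zero (X := id) (μ := gaussianReal 0 v)
    (by simp [integrableExpSet_id_gaussianReal]) k
  rw [mgf_id_gaussianReal] at h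
  simpa using h.symm

theorem gauss_iter (v : ℝ) (k : ℕ) :
    iteratedDeriv (k + 1) (fun t : ℝ => Real.exp (v * t ^ 2 / 2))
     = fun t => v * t * iteratedDeriv k (fun t : ℝ => Real.exp (v * t ^ 2 / 2)) t
        + k * v * iteratedDeriv (k - 1) (fun t : ℝ => Real.exp (v * t ^ 2 / 2)) t := by
  have hs : ContDiff ℝ ⊤ (fun t : ℝ => Real.exp (v * t ^ 2 / 2)) := by fun_prop
  have hd : ∀ k, Differentiable ℝ (iteratedDeriv k (fun t : ℝ => Real.exp (v * t ^ 2 / 2))) :=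
    fun k => hs.differentiable_iteratedDeriv k (by exact_mod_cast WithTop.coe_lt_top _)
  have hder : ∀ k t, HasDerivAt (iteratedDeriv k (fun t : ℝ => Real.exp (v * t ^ 2 / 2)))
      (iteratedDeriv (k+1) (fun t : ℝ => Real.exp (v * t ^ 2 / 2)) t) t := by
    intro k t
    rw [iteratedDeriv_succ]
    exact (hd k t).hasDerivAt
  induction k with
  | zero =>
    funext t
    have h : HasDerivAt (fun t : ℝ => Real.exp (v * t ^ 2 / 2))
      (Real.exp (v * t ^ 2 / 2) * (v * (2 * t) / 2)) t := by
      have := ((((hasDerivAt_id t).pow 2).const_mul v).div_const 2).exp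
      simpa using this
    simp [iteratedDeriv_one, h.deriv]
    ring
  | succ k ih =>
    funext t
    rw [iteratedDeriv_succ, ih]
    have h1 := (((hasDerivAt_id t).const_mul v).mul (hder k t))
    have h2 : HasDerivAt (fun t => k * v * iteratedDeriv (k - 1) (fun t : ℝ => Real.exp (v * t ^ 2 / 2)) t)
      (k * v * iteratedDeriv k (fun t : ℝ => Real.exp (v * t ^ 2 / 2)) t) t := by
      rcases k with _ | k
      · simpa using hasDerivAt_const t (0:ℝ)
      · exact (hder k t).const_mul _
    have h3 := h1.add h2
    refine Eq.trans (HasDerivAt.deriv h3) ?_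
    have h4 := congrFun ih t
    simp only [id, mul_one, Nat.add_sub_cancel, Nat.cast_add, Nat.cast_one] at h4 ⊢
    rw [h4]
    ring

theorem gaussMoment_succ (v : NNReal) (k : ℕ) : ∫ x, x ^ (k + 1) ∂(gaussianReal 0 v)
    = k * v * ∫ x, x ^ (k - 1) ∂(gaussianReal 0 v) := by
  rw [gaussMoment_eq, gaussMoment_eq, gauss_iter]
  simp

theorem gauss_integrable_pow (v : NNReal) (k : ℕ) :
    Integrable (fun x : ℝ => x ^ k) (gaussianReal 0 v) := by
  have := (memLp_id_gaussianReal (μ := 0) (v := v) k)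
  simpa using this.integrable_norm_pow'.mono' (f := fun x : ℝ => x ^ k) (by fun_prop) (by simp)

/-- product of the moments -/
noncomputable def momProd {ι : Type*} [Fintype ι] [DecidableEq ι] (M : ℕ → ℝ) (l : List ι) : ℝ :=
  ∏ b, M (l.count b)

/-- multiplicity of an index in a list -/
def cnt {ι : Type*} [DecidableEq ι] (l : List ι) (b : ι) : ℕ := l.count b

theorem list_prod_eq_aux {ι : Type*} [Fintype ι] [DecidableEq ι] (l : List ι) (f : ι → ℝ) :
    (l.map f).prod = ∏ b, f b ^ cnt l b := by
  rw [Finset.prod_list_map_count]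
  refine Finset.prod_subset (Finset.subset_univ _) ?_
  intro x _ hx
  simp [List.count_eq_zero.2 (by simpa using hx)]

theorem list_prod_eq {m n : ℕ} (l : List (Fin m × Fin n)) (W : Fin m → Fin n → ℝ) :
    (l.map fun b => W b.1 b.2).prod = ∏ i, ∏ j, W i j ^ cnt l (i, j) := by
  rw [list_prod_eq_aux, Fintype.prod_prod_type]

theorem integral_list_aux {m n : ℕ} (v : NNReal) (l : List (Fin m × Fin n)) :
    ∫ W, (l.map fun b => W b.1 b.2).prod
      ∂(Measure.pi fun _ : Fin m => Measure.pi fun _ : Fin n => gaussianReal 0 v)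
     = momProd (fun k => ∫ x, x ^ k ∂(gaussianReal 0 v)) l := by
  simp_rw [list_prod_eq]
  unfold momProd
  rw [integral_fintype_prod_eq_prod
    (f := fun i (w : Fin n → ℝ) => ∏ j, w j ^ cnt l (i, j)), ← Finset.univ_product_univ,
    Finset.prod_product]
  refine Finset.prod_congr rfl fun i _ => ?_
  rw [integral_fintype_prod_eq_prod (f := fun j (w : ℝ) => w ^ cnt l (i, j))]
  rfl

theorem integral_list {m n : ℕ} (σ : ℝ) (l : List (Fin m × Fin n)) :
    ∫ W, (l.map fun b => W b.1 b.2).prod ∂(gaussianMatrixMeasure m n σ)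
     = momProd (fun k => ∫ x, x ^ k ∂(gaussianReal 0 ⟨σ ^ 2, sq_nonneg σ⟩)) l :=
  integral_list_aux _ l

theorem integrable_list_aux {m n : ℕ} (v : NNReal) (l : List (Fin m × Fin n)) :
    Integrable (fun W : Fin m → Fin n → ℝ => (l.map fun b => W b.1 b.2).prod)
      (Measure.pi fun _ : Fin m => Measure.pi fun _ : Fin n => gaussianReal 0 v) := by
  simp_rw [list_prod_eq]
  refine Integrable.fintype_prod (f := fun i (w : Fin n → ℝ) => ∏ j, w j ^ cnt l (i, j)) ?_
  intro i
  refine Integrable.fintype_prod (f := fun j (w : ℝ) => w ^ cnt l (i, j)) ?_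
  intro j
  exact gauss_integrable_pow _ _

theorem integrable_list {m n : ℕ} (σ : ℝ) (l : List (Fin m × Fin n)) :
    Integrable (fun W : Fin m → Fin n → ℝ => (l.map fun b => W b.1 b.2).prod)
      (gaussianMatrixMeasure m n σ) :=
  integrable_list_aux _ l

theorem momProd_perm {ι : Type*} [Fintype ι] [DecidableEq ι] (M : ℕ → ℝ) {l l' : List ι}
    (h : l.Perm l') : momProd M l = momProd M l' := by
  simp [momProd, h.count_eq]

theorem momProd_cons {ι : Type*} [Fintype ι] [DecidableEq ι] (M : ℕ → ℝ) (v : ℝ)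
    (hM : ∀ k, M (k + 1) = k * v * M (k - 1)) (a : ι) (l : List ι) :
    momProd M (a :: l) = v * (l.count a * momProd M (l.erase a)) := by
  unfold momProd
  rw [← Finset.mul_prod_erase _ _ (Finset.mem_univ a),
    ← Finset.mul_prod_erase (s := Finset.univ) (a := a) (f := fun b => M ((l.erase a).count b))
      (Finset.mem_univ a)]
  rw [List.count_cons_self, hM, List.count_erase_self]
  have : ∏ x ∈ Finset.univ.erase a, M ((a :: l).count x)
      = ∏ x ∈ Finset.univ.erase a, M ((l.erase a).count x) := by
    refine Finset.prod_congr rfl fun x hx => ?_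
    have hx := Finset.ne_of_mem_erase hx
    rw [List.count_cons_of_ne hx.symm, List.count_erase_of_ne hx]
  rw [this]; ring

/-- all ways to pick an element out of a list -/
def picks {κ : Type*} : List κ → List (κ × List κ)
  | [] => []
  | b :: t => (b, t) :: (picks t).map fun c => (c.1, b :: c.2)

/-- all pairings of a list of length `2 k` -/
def pairings {κ : Type*} : ℕ → List κ → List (List (κ × κ))
  | 0, _ => [[]]
  | _ + 1, [] => []
  | k + 1, a :: l => (picks l).flatMap fun c => (pairings k c.2).map fun P => (a, c.1) :: P

theorem picks_length {κ : Type*} (l : List κ) : ∀ c ∈ picks l, c.2.length + 1 = l.length := by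
  induction l with
  | nil => simp [picks]
  | cons b t ih =>
    intro c hc
    simp only [picks, List.mem_cons, List.mem_map] at hc
    rcases hc with rfl | ⟨d, hd, rfl⟩
    · simp
    · simp [ih d hd]

theorem picks_sum {κ ι : Type*} [DecidableEq ι] (f : κ → ι) (a : ι) (l : List κ) :
    ∀ (Φ : List ι → ℝ) (_ : ∀ l l', l.Perm l' → Φ l = Φ l'),
    ((picks l).map fun c => if a = f c.1 then Φ (c.2.map f) else 0).sum
      = (l.map f).count a * Φ ((l.map f).erase a) := by
  induction l with
  | nil => simp [picks]
  | cons b t ih =>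
    intro Φ hΦ
    have := ih (fun s => Φ (f b :: s)) (fun l l' h => hΦ _ _ (h.cons _))
    simp only [picks, List.map_cons, List.sum_cons, List.map_map, Function.comp_def]
    rw [this]
    by_cases hab : a = f b
    · subst hab
      simp only [if_true, List.count_cons_self, List.erase_cons_head]
      by_cases hm : f b ∈ t.map f
      · rw [hΦ _ _ (List.perm_cons_erase hm).symm]; push_cast; ring
      · rw [List.count_eq_zero.2 hm]; simp
    · rw [List.count_cons_of_ne (Ne.symm hab), List.erase_cons_tail (by simpa using Ne.symm hab)]
      simp [hab]

theorem sum_flatMap' {κ : Type*} (L : List κ) (g : κ → List ℝ) :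
    (L.flatMap g).sum = (L.map fun c => (g c).sum).sum := by
  induction L with
  | nil => simp
  | cons a L ih => simp [ih]

theorem wick {κ ι : Type*} [Fintype ι] [DecidableEq ι] (M : ℕ → ℝ) (v : ℝ) (h0 : M 0 = 1)
    (hM : ∀ k, M (k + 1) = k * v * M (k - 1)) (f : κ → ι) (k : ℕ) :
    ∀ l : List κ, l.length = 2 * k → momProd M (l.map f) =
      v ^ k * ((pairings k l).map fun P => if ∀ e ∈ P, f e.1 = f e.2 then (1 : ℝ) else 0).sum := by
  induction k with
  | zero =>
    intro l hl
    obtain rfl : l = [] := by simpa using hl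
    simp [momProd, pairings, h0]
  | succ k ih =>
    intro l hl
    rcases l with _ | ⟨a, l⟩
    · simp at hl
    rw [List.map_cons, momProd_cons M v hM, ← picks_sum f (f a) l (momProd M)
      (fun _ _ h => momProd_perm M h), pairings, pow_succ', mul_assoc]
    congr 1
    rw [List.map_flatMap, sum_flatMap', ← List.sum_map_mul_left]
    congr 1
    refine List.map_congr_left fun c hc => ?_
    have hlen := picks_length l c hc
    rw [ih c.2 (by simp at hl; omega)]
    simp only [List.map_map, Function.comp_def, List.forall_mem_cons]
    by_cases h : f a = f c.1
    · simp only [h, if_true, true_and]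
    · simp [h]

/-- class representatives of the equivalence relation generated by a list of edges -/
def cls {κ : Type*} [DecidableEq κ] : List (κ × κ) → κ → κ
  | [] => id
  | e :: E => fun x => if cls E x = cls E e.1 then cls E e.2 else cls E x

theorem cls_edge {κ : Type*} [DecidableEq κ] (E : List (κ × κ)) :
    ∀ e ∈ E, cls E e.1 = cls E e.2 := by
  induction E with
  | nil => simp
  | cons d E ih =>
    intro e he
    rcases List.mem_cons.1 he with rfl | he
    · simp [cls]
    · simp [cls, ih e he]

theorem cls_idem {κ : Type*} [DecidableEq κ] (E : List (κ × κ)) :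
    ∀ x, cls E (cls E x) = cls E x := by
  induction E with
  | nil => simp [cls]
  | cons d E ih =>
    intro x
    simp only [cls]
    by_cases h : cls E x = cls E d.1 <;> simp [h, ih]

theorem cls_iff {κ α : Type*} [DecidableEq κ] (E : List (κ × κ)) (i : κ → α) :
    (∀ e ∈ E, i e.1 = i e.2) ↔ ∀ x, i (cls E x) = i x := by
  constructor
  · induction E with
    | nil => simp [cls]
    | cons d E ih =>
      intro h x
      have h1 := ih fun e he => h e (List.mem_cons_of_mem _ he)
      have h2 := h d List.mem_cons_self
      simp only [cls]
      split_ifs with hx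
      · rw [h1, ← h2, ← h1 d.1, ← hx, h1]
      · exact h1 x
  · intro h e he
    rw [← h e.1, cls_edge E e he, h]

theorem count_cls {κ α : Type*} [Fintype κ] [DecidableEq κ] [Fintype α] [DecidableEq α]
    (E : List (κ × κ)) :
    (∑ i : κ → α, if ∀ e ∈ E, i e.1 = i e.2 then (1 : ℝ) else 0)
      = (Fintype.card α : ℝ) ^ (Finset.univ.image (cls E)).card := by
  rw [Finset.sum_boole]
  norm_cast
  rw [← Fintype.card_coe (Finset.univ.image (cls E)), ← Fintype.card_fun, ← Fintype.card_subtype]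
  refine Fintype.card_congr
    { toFun := fun i x => i.1 x.1
      invFun := fun g => ⟨fun x => g ⟨cls E x, Finset.mem_image_of_mem _ (Finset.mem_univ x)⟩, ?_⟩
      left_inv := ?_
      right_inv := ?_ }
  · intro e he
    simp only [cls_edge E e he]
  · rintro ⟨i, hi⟩
    ext x
    exact (cls_iff E i).1 hi x
  · intro g
    funext ⟨x, hx⟩
    obtain ⟨y, -, rfl⟩ := Finset.mem_image.1 hx
    simp only [cls_idem]

def rowIx : Fin 8 → Fin 4 := ![0, 1, 1, 2, 2, 3, 3, 0]
def colIx : Fin 8 → Fin 4 := ![0, 0, 1, 1, 2, 2, 3, 3]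

def pairTypes : List (ℕ × ℕ) :=
  (pairings 4 [0, 1, 2, 3, 4, 5, 6, 7]).map fun P =>
    ((Finset.univ.image (cls (P.map fun e => (rowIx e.1, rowIx e.2)))).card,
      (Finset.univ.image (cls (P.map fun e => (colIx e.1, colIx e.2)))).card)

theorem sum_fin_succ_fun {α : Type*} [Fintype α] (k : ℕ) (F : (Fin (k + 1) → α) → ℝ) :
    ∑ i, F i = ∑ a, ∑ i : Fin k → α, F (Fin.cons a i) := by
  rw [← (Fin.consEquiv fun _ => α).sum_comp, Fintype.sum_prod_type]
  rfl

theorem sum_fin_four {α : Type*} [Fintype α] (F : α → α → α → α → ℝ) :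
    ∑ i : Fin 4 → α, F (i 0) (i 1) (i 2) (i 3) = ∑ a, ∑ b, ∑ c, ∑ d, F a b c d := by
  simp only [sum_fin_succ_fun, Finset.univ_unique, Finset.sum_singleton]
  rfl

theorem trace_expand {m n : ℕ} (W : Fin m → Fin n → ℝ) :
    ((Matrix.of W * (Matrix.of W)ᵀ) ^ 4).trace = ∑ i : Fin 4 → Fin m, ∑ j : Fin 4 → Fin n,
      ((([0, 1, 2, 3, 4, 5, 6, 7] : List (Fin 8)).map fun p => (i (rowIx p), j (colIx p))).map
        fun b => W b.1 b.2).prod := by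
  have h : ∀ i : Fin 4 → Fin m, ∑ j : Fin 4 → Fin n,
      ((([0, 1, 2, 3, 4, 5, 6, 7] : List (Fin 8)).map fun p => (i (rowIx p), j (colIx p))).map
        fun b => W b.1 b.2).prod
      = (∑ j, W (i 0) j * W (i 1) j) * (∑ j, W (i 1) j * W (i 2) j) *
        (∑ j, W (i 2) j * W (i 3) j) * (∑ j, W (i 3) j * W (i 0) j) := by
    intro i
    have := sum_fin_four fun a b c d : Fin n => W (i 0) a * W (i 1) a * (W (i 1) b * W (i 2) b) *
      (W (i 2) c * W (i 3) c) * (W (i 3) d * W (i 0) d)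
    simp only [← Finset.mul_sum, ← Finset.sum_mul] at this
    rw [← this]
    refine Finset.sum_congr rfl fun j _ => ?_
    simp [rowIx, colIx]
    ring
  simp_rw [h]
  rw [sum_fin_four fun a b c d : Fin m => (∑ j, W a j * W b j) * (∑ j, W b j * W c j) *
        (∑ j, W c j * W d j) * (∑ j, W d j * W a j)]
  have hS : ∀ a b, (Matrix.of W * (Matrix.of W)ᵀ) a b = ∑ j, W a j * W b j := by
    intro a b; simp [Matrix.mul_apply]
  simp_rw [← hS]
  generalize Matrix.of W * (Matrix.of W)ᵀ = S
  rw [show S ^ 4 = S * (S * (S * S)) by simp only [pow_succ, pow_zero, one_mul, mul_assoc]]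
  simp only [Matrix.trace, Matrix.diag_apply, Matrix.mul_apply, Finset.mul_sum]
  simp only [mul_assoc]

theorem pairTypes_perm : pairTypes.Perm
    ([(1, 4), (4, 1)] ++ List.replicate 6 (2, 3) ++ List.replicate 6 (3, 2) ++
      List.replicate 6 (1, 3) ++ List.replicate 6 (3, 1) ++ List.replicate 17 (2, 2) ++
      List.replicate 21 (1, 2) ++ List.replicate 21 (2, 1) ++ List.replicate 20 (1, 1)) := by
  decide +kernel

theorem pairTypes_sum (x y : ℝ) : (pairTypes.map fun c => x ^ c.1 * y ^ c.2).sum =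
    y * x * (y ^ 3 + x ^ 3 + 6 * y ^ 2 * x + 6 * y * x ^ 2 +
          6 * y ^ 2 + 6 * x ^ 2 + 17 * y * x + 21 * y + 21 * x + 20) := by
  rw [(pairTypes_perm.map _).sum_eq]
  simp only [List.map_append, List.map_replicate, List.sum_append, List.sum_replicate,
    List.map_cons, List.map_nil, List.sum_cons, List.sum_nil, nsmul_eq_mul]
  push_cast
  ring

/-- With `W` a random real `m × n` matrix with i.i.d. centered Gaussian
entries of variance `σ²` and `S = W Wᵀ`, one has
`E[tr (S⁴)] = σ⁸ n m (n³ + m³ + 6 n² m + 6 n m² + 6 n² + 6 m² + 17 n m + 21 n + 21 m + 20)`. -/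
theorem stmt_12 (m n : ℕ) (hm : 0 < m) (hn : 0 < n) (σ : ℝ) (hσ : 0 < σ) :
    ∫ W : Fin m → Fin n → ℝ, ((Matrix.of W * (Matrix.of W)ᵀ) ^ 4).trace
        ∂(gaussianMatrixMeasure m n σ) =
      σ ^ 8 * ((n : ℝ) * m) *
        ((n : ℝ) ^ 3 + (m : ℝ) ^ 3 + 6 * (n : ℝ) ^ 2 * m + 6 * n * (m : ℝ) ^ 2 +
          6 * (n : ℝ) ^ 2 + 6 * (m : ℝ) ^ 2 + 17 * n * m + 21 * n + 21 * m + 20) := by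
  simp_rw [trace_expand]
  rw [integral_finsetSum _ fun i _ => integrable_finsetSum _ fun j _ => integrable_list σ _]
  have hw : ∀ (i : Fin 4 → Fin m) (j : Fin 4 → Fin n), _ := fun i j =>
    wick (fun k => ∫ x, x ^ k ∂(gaussianReal 0 ⟨σ ^ 2, sq_nonneg σ⟩)) (σ ^ 2)
      (gaussMoment_zero _) (fun k => gaussMoment_succ _ k)
      (fun p : Fin 8 => (i (rowIx p), j (colIx p))) 4 [0, 1, 2, 3, 4, 5, 6, 7] rfl
  have h1 : ∀ i : Fin 4 → Fin m, ∫ W, ∑ j : Fin 4 → Fin n,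
      ((([0, 1, 2, 3, 4, 5, 6, 7] : List (Fin 8)).map fun p => (i (rowIx p), j (colIx p))).map
        fun b => W b.1 b.2).prod ∂(gaussianMatrixMeasure m n σ)
      = ∑ j : Fin 4 → Fin n, (σ ^ 2) ^ 4 *
        ((pairings 4 ([0, 1, 2, 3, 4, 5, 6, 7] : List (Fin 8))).map fun P =>
          (if ∀ e ∈ P.map (fun e => (rowIx e.1, rowIx e.2)), i e.1 = i e.2 then (1 : ℝ) else 0) *
          (if ∀ e ∈ P.map (fun e => (colIx e.1, colIx e.2)), j e.1 = j e.2 then (1 : ℝ) else 0)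
          ).sum := by
    intro i
    rw [integral_finsetSum _ fun j _ => integrable_list σ _]
    refine Finset.sum_congr rfl fun j _ => ?_
    rw [integral_list, hw]
    congr 2
    refine List.map_congr_left fun P _ => ?_
    simp only [List.forall_mem_map, Prod.mk.injEq, forall_and, ite_and, ite_mul, one_mul, zero_mul]
  simp_rw [h1, ← Finset.mul_sum]
  have h2 : ∀ L : List (List (Fin 8 × Fin 8)), ∑ i : Fin 4 → Fin m, ∑ j : Fin 4 → Fin n,
        (L.map fun P =>
          (if ∀ e ∈ P.map (fun e => (rowIx e.1, rowIx e.2)), i e.1 = i e.2 then (1 : ℝ) else 0) *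
          (if ∀ e ∈ P.map (fun e => (colIx e.1, colIx e.2)), j e.1 = j e.2 then (1 : ℝ) else 0)
          ).sum = (L.map fun P =>
      (m : ℝ) ^ ((Finset.univ.image (cls (P.map fun e => (rowIx e.1, rowIx e.2)))).card) *
      (n : ℝ) ^ ((Finset.univ.image (cls (P.map fun e => (colIx e.1, colIx e.2)))).card)).sum := by
    intro L
    induction L with
    | nil => simp
    | cons P L ih =>
      simp only [List.map_cons, List.sum_cons, Finset.sum_add_distrib]
      rw [ih, ← Finset.sum_mul_sum, count_cls, count_cls]
      simp
  rw [h2]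
  have h3 := pairTypes_sum m n
  unfold pairTypes at h3
  rw [List.map_map] at h3
  rw [show (σ ^ 2) ^ 4 = σ ^ 8 by ring, mul_assoc, ← h3]
  rfl
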